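/- Suppose q is a prime dividing both P and Q. Then for every positive integer n, q^{⌊log_q n⌋} divides v_n; in fact q^{⌊n/2⌋+1} divides v_n when q = 2, and q^{⌊(n+1)/2⌋} divides v_n when q ≥ 3. Consequently, every positive integer n all of whose prime factors divide both P and Q satisfies n ∣ v_n. -/

import Mathlib

/-- Lucas sequence of the second kind: `v 0 = 2`, `v 1 = P`,
`v (n+2) = P * v (n+1) - Q * v n`. -/
def lucasV (P Q : ℤ) : ℕ → ℤ
  | 0 => 2
  | 1 => P
  | n + 2 => P * lucasV P Q (n + 1) - Q * lucasV P Q n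

theorem lucasV_add_two (P Q : ℤ) (n : ℕ) :
    lucasV P Q (n + 2) = P * lucasV P Q (n + 1) - Q * lucasV P Q n := rfl

theorem pow_half_succ_dvd_lucasV {P Q a : ℤ} (hP : a ∣ P) (hQ : a ∣ Q) :
    ∀ n : ℕ, a ^ ((n + 1) / 2) ∣ lucasV P Q n
  | 0 => by simp
  | 1 => by simpa [lucasV] using hP
  | n + 2 => by
    rw [lucasV_add_two, show (n + 2 + 1) / 2 = (n + 1) / 2 + 1 by lia, pow_succ']
    refine dvd_sub (mul_dvd_mul hP ?_) (mul_dvd_mul hQ (pow_half_succ_dvd_lucasV hP hQ n))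
    exact (pow_dvd_pow a (by lia)).trans (pow_half_succ_dvd_lucasV hP hQ (n + 1))

theorem two_pow_dvd_lucasV {P Q : ℤ} (hP : 2 ∣ P) (hQ : 2 ∣ Q) :
    ∀ n : ℕ, 2 ^ (n / 2 + 1) ∣ lucasV P Q n
  | 0 => by simp [lucasV]
  | 1 => by simpa [lucasV] using hP
  | n + 2 => by
    rw [lucasV_add_two, show (n + 2) / 2 + 1 = n / 2 + 1 + 1 by lia, pow_succ']
    refine dvd_sub (mul_dvd_mul hP ?_) (mul_dvd_mul hQ (two_pow_dvd_lucasV hP hQ n))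
    exact (pow_dvd_pow 2 (by lia)).trans (two_pow_dvd_lucasV hP hQ (n + 1))

theorem Nat.log_le_half_succ {b : ℕ} (hb : 2 ≤ b) {n : ℕ} (hn : 0 < n) :
    Nat.log b n ≤ (n + 1) / 2 := by
  refine Nat.lt_succ_iff.mp (Nat.log_lt_of_lt_pow hn.ne' ?_)
  have h : (n + 1) / 2 < 2 ^ ((n + 1) / 2) := Nat.lt_two_pow_self
  calc n < 2 ^ ((n + 1) / 2 + 1) := by rw [pow_succ]; lia
    _ ≤ b ^ ((n + 1) / 2 + 1) := Nat.pow_le_pow_left hb _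

theorem pow_log_dvd_lucasV {P Q : ℤ} {b : ℕ} (hb : 2 ≤ b) (hP : (b : ℤ) ∣ P)
    (hQ : (b : ℤ) ∣ Q) {n : ℕ} (hn : 0 < n) : (b : ℤ) ^ Nat.log b n ∣ lucasV P Q n :=
  (pow_dvd_pow _ (Nat.log_le_half_succ hb hn)).trans (pow_half_succ_dvd_lucasV hP hQ n)

/-- If the prime `q` divides both `P` and `Q`, then
`q^⌊log_q n⌋ ∣ v_n` (indeed `2^(⌊n/2⌋+1) ∣ v_n` if `q = 2`, and
`q^⌊(n+1)/2⌋ ∣ v_n` if `q ≥ 3`); consequently every positive integer all of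
whose prime factors divide both `P` and `Q` lies in `T`. -/
theorem special_prime_pow_dvd_lucasV (P Q : ℤ) (q : ℕ) (hq : q.Prime)
    (hP : (q : ℤ) ∣ P) (hQ : (q : ℤ) ∣ Q) :
    (∀ n : ℕ, 0 < n →
      ((q : ℤ) ^ (Nat.log q n) ∣ lucasV P Q n ∧
        (q = 2 → (q : ℤ) ^ (n / 2 + 1) ∣ lucasV P Q n) ∧
        (3 ≤ q → (q : ℤ) ^ ((n + 1) / 2) ∣ lucasV P Q n))) ∧
    (∀ n : ℕ, 0 < n → (∀ p : ℕ, p.Prime → p ∣ n → (p : ℤ) ∣ P ∧ (p : ℤ) ∣ Q) →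
      (n : ℤ) ∣ lucasV P Q n) := by
  refine ⟨fun n hn => ⟨pow_log_dvd_lucasV hq.two_le hP hQ hn, ?_,
    fun _ => pow_half_succ_dvd_lucasV hP hQ n⟩, fun n hn h => ?_⟩
  · rintro rfl
    exact two_pow_dvd_lucasV hP hQ n
  · rw [Int.natCast_dvd, Nat.dvd_iff_prime_pow_dvd_dvd]
    intro p k hp hk
    rcases Nat.eq_zero_or_pos k with rfl | hk0
    · simp
    obtain ⟨hpP, hpQ⟩ := h p hp ((dvd_pow_self p hk0.ne').trans hk)
    rw [← Int.natCast_dvd, Nat.cast_pow]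
    exact (pow_dvd_pow _ (Nat.le_log_of_pow_le hp.one_lt (Nat.le_of_dvd hn hk))).trans
      (pow_log_dvd_lucasV hp.two_le hpP hpQ hn)
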